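/- Let a > 0, b > 0 and let μ, ν be real numbers with ν non-integer and μ + 1 > |ν|. Then ∫_0^∞ t^{μ+ν+1} J_μ(at) K_ν(bt) dt = (2a)^μ (2b)^ν Γ(μ+ν+1) / (a² + b²)^{μ+ν+1}. -/

import Mathlib

open MeasureTheory Real Filter

noncomputable def besselJ (ν t : ℝ) : ℝ :=
  ∑' r : ℕ, (-1 : ℝ) ^ r * t ^ (ν + 2 * (r : ℝ)) /
    ((2 : ℝ) ^ (ν + 2 * (r : ℝ)) * (Nat.factorial r : ℝ) * Real.Gamma (ν + (r : ℝ) + 1))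

noncomputable def besselI (ν t : ℝ) : ℝ :=
  ∑' r : ℕ, t ^ (ν + 2 * (r : ℝ)) /
    ((2 : ℝ) ^ (ν + 2 * (r : ℝ)) * (Nat.factorial r : ℝ) * Real.Gamma (ν + (r : ℝ) + 1))

noncomputable def besselK (ν t : ℝ) : ℝ :=
  Real.pi / (2 * Real.sin (ν * Real.pi)) * (besselI (-ν) t - besselI ν t)

noncomputable def besselN (ν t : ℝ) : ℝ :=
  (besselJ ν t * Real.cos (ν * Real.pi) - besselJ (-ν) t) / Real.sin (ν * Real.pi)

noncomputable def hyperF (a b c z : ℝ) : ℝ :=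
  ∑' m : ℕ, ((ascPochhammer ℝ m).eval a * (ascPochhammer ℝ m).eval b /
    (ascPochhammer ℝ m).eval c) * z ^ m / (Nat.factorial m : ℝ)


/-- reciprocal Gamma -/
noncomputable def rG (ν : ℝ) : ℝ := (Real.Gamma ν)⁻¹

theorem rG_rec (ν : ℝ) : rG ν = ν * rG (ν + 1) := by
  unfold rG
  by_cases h : ν = 0
  · subst h; simp [Real.Gamma_zero]
  · rw [Real.Gamma_add_one h]
    field_simp

theorem rG_bdd (ν : ℝ) : ∃ C : ℝ, 0 ≤ C ∧ ∀ r : ℕ, |rG (ν + r + 1)| ≤ C := by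
  obtain ⟨N, hN⟩ := exists_nat_gt (-ν)
  refine ⟨∑ i ∈ Finset.range (N + 1), |rG (ν + i + 1)|, Finset.sum_nonneg (fun _ _ => abs_nonneg _), ?_⟩
  intro r
  induction r with
  | zero =>
    exact Finset.single_le_sum (f := fun i : ℕ => |rG (ν + i + 1)|) (fun _ _ => abs_nonneg _)
      (Finset.mem_range.2 (Nat.succ_pos N))
  | succ k ih =>
    by_cases hk : k + 1 < N + 1
    · exact Finset.single_le_sum (f := fun i : ℕ => |rG (ν + i + 1)|) (fun _ _ => abs_nonneg _)
        (Finset.mem_range.2 hk)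
    · have hk' : (N : ℝ) ≤ k := by exact_mod_cast (by omega : N ≤ k)
      have h1 : (1 : ℝ) ≤ ν + k + 1 := by linarith
      have h2 := rG_rec (ν + k + 1)
      rw [h2, abs_mul, abs_of_pos (by linarith : 0 < ν + k + 1)] at ih
      have e : ν + ((k + 1 : ℕ) : ℝ) + 1 = ν + k + 1 + 1 := by push_cast; ring
      rw [e]
      nlinarith [abs_nonneg (rG (ν + k + 1 + 1))]

/-- the entire function `∑ x^r / (r! Γ(ν+r+1))` -/
noncomputable def bE (ν x : ℝ) : ℝ := ∑' r : ℕ, x ^ r / (Nat.factorial r : ℝ) * rG (ν + r + 1)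

theorem bE_summable (ν x : ℝ) : Summable (fun r : ℕ => x ^ r / (Nat.factorial r : ℝ) * rG (ν + r + 1)) := by
  obtain ⟨C, hC, h⟩ := rG_bdd ν
  have := (Real.summable_pow_div_factorial |x|).mul_right C
  refine Summable.of_norm_bounded this (fun r => ?_)
  rw [Real.norm_eq_abs, abs_mul, abs_div, abs_pow, Nat.abs_cast]
  gcongr
  exact h r

theorem bE_shift (ν x : ℝ) (r : ℕ) : ((r + 1 : ℕ) : ℝ) * x ^ (r + 1 - 1) / (Nat.factorial (r + 1) : ℝ) * rG (ν + (r + 1 : ℕ) + 1)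
    = x ^ r / (Nat.factorial r : ℝ) * rG (ν + 1 + r + 1) := by
  have e : ν + ((r + 1 : ℕ) : ℝ) + 1 = ν + 1 + r + 1 := by push_cast; ring
  rw [e, Nat.factorial_succ]
  have : (Nat.factorial r : ℝ) ≠ 0 := by positivity
  have : (r : ℝ) + 1 ≠ 0 := by positivity
  simp only [Nat.add_sub_cancel]
  push_cast
  field_simp

theorem bE_dsum (ν x : ℝ) : Summable (fun r : ℕ => (r : ℝ) * x ^ (r - 1) / (Nat.factorial r : ℝ) * rG (ν + r + 1)) ∧
    ∑' r : ℕ, (r : ℝ) * x ^ (r - 1) / (Nat.factorial r : ℝ) * rG (ν + r + 1) = bE (ν + 1) x := by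
  have hs : Summable (fun r : ℕ => (r : ℝ) * x ^ (r - 1) / (Nat.factorial r : ℝ) * rG (ν + r + 1)) := by
    rw [← summable_nat_add_iff 1]
    simp only [bE_shift]
    exact bE_summable (ν + 1) x
  refine ⟨hs, ?_⟩
  rw [hs.tsum_eq_zero_add]
  simp only [bE_shift]
  simp [bE]

theorem bE_hasDerivAt (ν x : ℝ) : HasDerivAt (bE ν) (bE (ν + 1) x) x := by
  obtain ⟨C, hC, h⟩ := rG_bdd ν
  set R := |x| + 1 with hR
  have hu : Summable (fun r : ℕ => (r : ℝ) * R ^ (r - 1) / (Nat.factorial r : ℝ) * C) := by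
    refine Summable.mul_right C ?_
    rw [← summable_nat_add_iff 1]
    refine (Real.summable_pow_div_factorial R).congr (fun r => ?_)
    rw [Nat.factorial_succ]
    have : (Nat.factorial r : ℝ) ≠ 0 := by positivity
    have : (r : ℝ) + 1 ≠ 0 := by positivity
    simp only [Nat.add_sub_cancel]
    push_cast
    field_simp
  have := hasDerivAt_tsum_of_isPreconnected (t := Metric.ball (0 : ℝ) R)
    (g := fun (r : ℕ) (y : ℝ) => y ^ r / (Nat.factorial r : ℝ) * rG (ν + r + 1))
    (g' := fun (r : ℕ) (y : ℝ) => (r : ℝ) * y ^ (r - 1) / (Nat.factorial r : ℝ) * rG (ν + r + 1))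
    (y₀ := x) (y := x)
    hu Metric.isOpen_ball (convex_ball _ _).isPreconnected ?_ ?_ ?_ (bE_summable ν x) ?_
  · rw [(bE_dsum ν x).2] at this
    exact this
  · intro r y _
    exact ((hasDerivAt_pow r y).div_const _).mul_const _
  · intro r y hy
    have hy' : |y| ≤ R := by
      have := mem_ball_zero_iff.1 hy
      exact this.le
    rw [Real.norm_eq_abs, abs_mul, abs_div, abs_mul, abs_pow, Nat.abs_cast, Nat.abs_cast]
    gcongr
    exact h r
  · rw [mem_ball_zero_iff, Real.norm_eq_abs]; linarith
  · rw [mem_ball_zero_iff, Real.norm_eq_abs]; linarith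

theorem bE_rec (ν x : ℝ) : bE ν x = (ν + 1) * bE (ν + 1) x + x * bE (ν + 2) x := by
  have e : ν + 2 = ν + 1 + 1 := by ring
  rw [e, ← (bE_dsum (ν + 1) x).2]
  conv_rhs => rw [bE, ← tsum_mul_left, ← tsum_mul_left]
  rw [← Summable.tsum_add ((bE_summable (ν + 1) x).mul_left _) ((bE_dsum (ν + 1) x).1.mul_left _)]
  refine tsum_congr (fun r => ?_)
  rw [rG_rec (ν + r + 1)]
  have e : ν + 1 + r + 1 = ν + r + 1 + 1 := by ring
  rw [e]
  rcases r with _ | r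
  · simp
  · simp only [Nat.add_sub_cancel]
    push_cast
    ring

theorem bE_zero (ν : ℝ) : bE ν 0 = rG (ν + 1) := by
  rw [bE, tsum_eq_single 0]
  · simp
  · intro r hr; simp [hr]

theorem bE_cont (ν : ℝ) : Continuous (bE ν) :=
  continuous_iff_continuousAt.2 fun x => (bE_hasDerivAt ν x).continuousAt

theorem bE_pos (ν x : ℝ) (hν : -1 < ν) (hx : 0 < x) : 0 < bE ν x := by
  have hp : ∀ r : ℕ, 0 < x ^ r / (Nat.factorial r : ℝ) * rG (ν + r + 1) := by
    intro r
    have h0 : (0 : ℝ) ≤ r := r.cast_nonneg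
    have : 0 < rG (ν + r + 1) := inv_pos.2 (Real.Gamma_pos_of_pos (by linarith))
    positivity
  exact (bE_summable ν x).tsum_pos (fun r => (hp r).le) 0 (hp 0)

theorem bE_neg_bound (ν y : ℝ) (hν : -1 / 2 ≤ ν) (hy : 0 ≤ y) : |bE ν (-y)| ≤ |rG (ν + 1)| := by
  have hd : ∀ (c z : ℝ), HasDerivAt (fun z => bE c (-z)) (-bE (c + 1) (-z)) z := by
    intro c z
    have := (bE_hasDerivAt c (-z)).comp z (hasDerivAt_neg z)
    simpa [Function.comp_def] using this
  have hd2 : ∀ z, HasDerivAt (fun z => bE ν (-z) ^ 2 + z * bE (ν + 1) (-z) ^ 2)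
      (-(2 * ν + 1) * bE (ν + 1) (-z) ^ 2) z := by
    intro z
    refine (((hd ν z).pow 2).add ((hasDerivAt_id z).mul ((hd (ν + 1) z).pow 2))).congr_deriv ?_
    have := bE_rec ν (-z)
    have e : ν + 1 + 1 = ν + 2 := by ring
    rw [e]
    simp only [id]
    push_cast
    simp only [Pi.pow_apply]
    linear_combination (-2 * bE (ν + 1) (-z)) * this
  have han := antitone_of_hasDerivAt_nonpos hd2 (fun z => by
    show -(2 * ν + 1) * bE (ν + 1) (-z) ^ 2 ≤ 0
    nlinarith [sq_nonneg (bE (ν + 1) (-z))])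
  have := han hy
  simp only [neg_zero, bE_zero, zero_mul, add_zero] at this
  apply sq_le_sq.1
  nlinarith [mul_nonneg hy (sq_nonneg (bE (ν + 1) (-y)))]

theorem bE_neg_bound' (ν : ℝ) (hν : -1 < ν) : ∃ C : ℝ, 0 ≤ C ∧ ∀ y, 0 ≤ y → |bE ν (-y)| ≤ C * (1 + y) := by
  refine ⟨|ν + 1| * |rG (ν + 1 + 1)| + |rG (ν + 2 + 1)|, by positivity, fun y hy => ?_⟩
  rw [bE_rec ν (-y)]
  have h1 := bE_neg_bound (ν + 1) y (by linarith) hy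
  have h2 := bE_neg_bound (ν + 2) y (by linarith) hy
  calc _ ≤ |ν + 1| * |bE (ν + 1) (-y)| + y * |bE (ν + 2) (-y)| := by
        refine (abs_add_le _ _).trans ?_
        rw [abs_mul, abs_mul, abs_neg, abs_of_nonneg hy]
    _ ≤ |ν + 1| * |rG (ν + 1 + 1)| + y * |rG (ν + 2 + 1)| := by gcongr
    _ ≤ _ := by
        have : 0 ≤ |ν + 1| * |rG (ν + 1 + 1)| := by positivity
        nlinarith [abs_nonneg (rG (ν + 2 + 1))]

/-- the integral `∫ s^(-ν-1) exp(-s-x/s)` -/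
noncomputable def bF (ν x : ℝ) : ℝ := ∫ s in Set.Ioi (0 : ℝ), s ^ (-ν - 1) * Real.exp (-s - x / s)

theorem gam_int {c q : ℝ} (hc : -1 < c) (hq : 0 < q) :
    IntegrableOn (fun s : ℝ => s ^ c * Real.exp (-(q * s))) (Set.Ioi 0) := by
  have := integrableOn_rpow_mul_exp_neg_mul_rpow (p := 1) hc one_pos hq
  simpa using this

theorem bF_meas (c x : ℝ) : AEStronglyMeasurable (fun s : ℝ => s ^ c * Real.exp (-s - x / s))
    (volume.restrict (Set.Ioi 0)) := by
  have : Measurable (fun s : ℝ => s ^ c * Real.exp (-s - x / s)) := by fun_prop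
  exact this.aestronglyMeasurable

theorem bF_int (c x : ℝ) (hx : 0 < x) :
    IntegrableOn (fun s : ℝ => s ^ c * Real.exp (-s - x / s)) (Set.Ioi 0) := by
  obtain ⟨n, hn⟩ := exists_nat_gt (-c)
  have h1 := (gam_int (c := c + n) (q := 1) (by linarith) one_pos).const_mul ((Nat.factorial n : ℝ) / x ^ n)
  refine Integrable.mono' h1 (bF_meas c x) ?_
  refine (ae_restrict_iff' measurableSet_Ioi).2 (Eventually.of_forall fun s hs => ?_)
  have hs : 0 < s := hs
  rw [Real.norm_eq_abs, abs_of_nonneg (by positivity)]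
  have h2 := Real.pow_div_factorial_le_exp (x / s) (by positivity) n
  have h3 : Real.exp (-(x / s)) ≤ (Nat.factorial n : ℝ) / x ^ n * s ^ n := by
    rw [Real.exp_neg]
    have : (x / s) ^ n / (Nat.factorial n : ℝ) = ((Nat.factorial n : ℝ) / x ^ n * s ^ n)⁻¹ := by
      rw [div_pow]; field_simp
    rw [this] at h2
    exact inv_le_of_inv_le₀ (by positivity) h2
  rw [sub_eq_add_neg, Real.exp_add, Real.rpow_add hs, Real.rpow_natCast, one_mul]
  calc s ^ c * (Real.exp (-s) * Real.exp (-(x / s))) ≤ s ^ c * (Real.exp (-s) * ((Nat.factorial n : ℝ) / x ^ n * s ^ n)) := by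
        gcongr
    _ = _ := by ring

theorem bF_hasDerivAt (ν x : ℝ) (hx : 0 < x) : HasDerivAt (bF ν) (-bF (ν + 1) x) x := by
  have h := hasDerivAt_integral_of_dominated_loc_of_deriv_le (μ := volume.restrict (Set.Ioi (0 : ℝ)))
    (F := fun (x s : ℝ) => s ^ (-ν - 1) * Real.exp (-s - x / s))
    (F' := fun (x s : ℝ) => -(s ^ (-(ν + 1) - 1) * Real.exp (-s - x / s)))
    (bound := fun s => s ^ (-(ν + 1) - 1) * Real.exp (-s - (x / 2) / s))
    (x₀ := x) (s := Set.Ioi (x / 2)) (Ioi_mem_nhds (by linarith))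
    (Eventually.of_forall fun y => bF_meas _ y) (bF_int _ x hx) (bF_meas _ x).neg ?_
    (bF_int _ (x / 2) (by linarith)) ?_
  · have h2 := h.2
    rw [integral_neg] at h2
    exact h2
  · refine (ae_restrict_iff' measurableSet_Ioi).2 (Eventually.of_forall fun s hs y hy => ?_)
    have hs : 0 < s := hs
    have hy : x / 2 < y := hy
    rw [norm_neg, Real.norm_eq_abs, abs_of_nonneg (by positivity)]
    gcongr
  · refine (ae_restrict_iff' measurableSet_Ioi).2 (Eventually.of_forall fun s hs y hy => ?_)
    have hs : 0 < s := hs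
    have h1 : HasDerivAt (fun y : ℝ => -s - y / s) (-(1 / s)) y := by
      simpa using ((hasDerivAt_id y).div_const s).const_sub (-s)
    refine ((h1.exp).const_mul (s ^ (-ν - 1))).congr_deriv ?_
    have : s ^ (-(ν + 1) - 1) = s ^ (-ν - 1) / s := by
      rw [← Real.rpow_sub_one hs.ne']; congr 1; ring
    rw [this]
    field_simp

theorem bF_symm (ν x : ℝ) (hx : 0 < x) : bF (-ν) x = x ^ ν * bF ν x := by
  have h1 := integral_comp_rpow_Ioi (fun s : ℝ => s ^ (-ν - 1) * Real.exp (-s - x / s)) (p := -1) (by norm_num)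
  have h2 := integral_comp_mul_left_Ioi' (fun s : ℝ => (|(-1 : ℝ)| * s ^ ((-1 : ℝ) - 1)) • ((s ^ (-1 : ℝ)) ^ (-ν - 1) * Real.exp (-(s ^ (-1 : ℝ)) - x / s ^ (-1 : ℝ)))) 0 (b := x⁻¹) (by positivity)
  rw [mul_zero, h1] at h2
  unfold bF
  rw [← h2, smul_eq_mul, ← integral_const_mul, ← integral_const_mul]
  refine setIntegral_congr_fun measurableSet_Ioi fun s hs => ?_
  have hs : 0 < s := hs
  have e1 : (x⁻¹ * s) ^ (-1 : ℝ) = x / s := by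
    rw [Real.rpow_neg_one]; field_simp
  simp only [e1, smul_eq_mul]
  have e2 : x / (x / s) = s := by field_simp
  rw [e2]
  have e3 : (x⁻¹ * s) ^ ((-1 : ℝ) - 1) = (x / s) ^ (2 : ℝ) := by
    rw [← e1, ← Real.rpow_mul (by positivity)]; norm_num
  rw [e3]
  have e4 : (x / s) ^ (2 : ℝ) * (x / s) ^ (-ν - 1) = x * x ^ (-ν) * s ^ (- -ν - 1) := by
    rw [← Real.rpow_add (by positivity), Real.div_rpow hx.le hs.le]
    rw [show (2 : ℝ) + (-ν - 1) = 1 + -ν by ring, Real.rpow_add hx, Real.rpow_one,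
      div_eq_mul_inv, ← Real.rpow_neg hs.le]
    congr 2; ring
  have e5 : -(x / s) - s = -s - x / s := by ring
  have e6 : x ^ ν * x ^ (-ν) = 1 := by
    rw [← Real.rpow_add hx]; simp
  rw [e5]
  norm_num
  norm_num at e4
  have e7 : x ^ ν * (x⁻¹ * ((x / s) ^ 2 * ((x / s) ^ (-ν - 1) * Real.exp (-s - x / s)))) =
    x ^ ν * x⁻¹ * ((x / s) ^ 2 * (x / s) ^ (-ν - 1)) * Real.exp (-s - x / s) := by ring
  rw [e7, e4]
  have : x ^ ν * x⁻¹ * (x * x ^ (-ν) * s ^ (ν - 1)) = (x ^ ν * x ^ (-ν)) * (x⁻¹ * x) * s ^ (ν - 1) := by ring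
  rw [this, e6, inv_mul_cancel₀ hx.ne']
  ring

theorem bF_lim (ν : ℝ) (hν : ν < 0) : Tendsto (bF ν) (nhdsWithin 0 (Set.Ioi 0)) (nhds (Real.Gamma (-ν))) := by
  have e : Real.Gamma (-ν) = ∫ s in Set.Ioi (0 : ℝ), s ^ (-ν - 1) * Real.exp (-s - 0 / s) := by
    rw [Real.Gamma_eq_integral (by linarith)]
    refine setIntegral_congr_fun measurableSet_Ioi fun s hs => ?_
    simp [mul_comm]
  rw [e]
  have hb := gam_int (c := -ν - 1) (q := 1) (by linarith) one_pos
  refine tendsto_integral_filter_of_dominated_convergence (fun s : ℝ => s ^ (-ν - 1) * Real.exp (-(1 * s)))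
    (Eventually.of_forall fun y => bF_meas _ y) ?_ hb ?_
  · filter_upwards [self_mem_nhdsWithin] with y hy
    refine (ae_restrict_iff' measurableSet_Ioi).2 (Eventually.of_forall fun s hs => ?_)
    have hs : 0 < s := hs
    have hy : 0 < y := hy
    rw [Real.norm_eq_abs, abs_of_nonneg (by positivity)]
    gcongr
    have : 0 < y / s := by positivity
    linarith
  · refine (ae_restrict_iff' measurableSet_Ioi).2 (Eventually.of_forall fun s hs => ?_)
    have : Continuous (fun y : ℝ => s ^ (-ν - 1) * Real.exp (-s - y / s)) := by fun_prop
    exact (this.tendsto 0).mono_left nhdsWithin_le_nhds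

/-- the difference between the integral and the series -/
noncomputable def bR (ν x : ℝ) : ℝ :=
  Real.pi / Real.sin (ν * Real.pi) * (x ^ (-ν) * bE (-ν) x - bE ν x)

noncomputable def bH (ν x : ℝ) : ℝ := bF ν x - bR ν x

theorem bR_hasDerivAt (ν x : ℝ) (hx : 0 < x) : HasDerivAt (bR ν) (-bR (ν + 1) x) x := by
  have h1 := (Real.hasDerivAt_rpow_const (p := -ν) (Or.inl hx.ne')).mul (bE_hasDerivAt (-ν) x)
  have h2 := (h1.sub (bE_hasDerivAt ν x)).const_mul (Real.pi / Real.sin (ν * Real.pi))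
  refine h2.congr_deriv ?_
  unfold bR
  have e : Real.sin ((ν + 1) * Real.pi) = -Real.sin (ν * Real.pi) := by
    rw [add_mul, one_mul, Real.sin_add_pi]
  have r := bE_rec (-(ν + 1)) x
  rw [show -(ν + 1) + 1 = -ν by ring, show -(ν + 1) + 2 = -ν + 1 by ring] at r
  rw [e, r, show -(ν + 1) = -ν - 1 by ring, Real.rpow_sub_one hx.ne']
  field_simp

theorem bH_hasDerivAt (ν x : ℝ) (hx : 0 < x) : HasDerivAt (bH ν) (-bH (ν + 1) x) x := by
  refine ((bF_hasDerivAt ν x hx).sub (bR_hasDerivAt ν x hx)).congr_deriv ?_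
  unfold bH; ring

theorem bH_symm (ν x : ℝ) (hx : 0 < x) : bH (-ν) x = x ^ ν * bH ν x := by
  unfold bH
  rw [bF_symm ν x hx]
  have e6 : x ^ ν * x ^ (-ν) = 1 := by
    rw [← Real.rpow_add hx]; simp
  unfold bR
  rw [neg_mul, Real.sin_neg, neg_neg]
  linear_combination (-Real.pi / Real.sin (ν * Real.pi) * bE (-ν) x * (-1)) * e6

theorem bH_lim (ν : ℝ) (h1 : -1 < ν) (h0 : ν < 0) : Tendsto (bH ν) (nhdsWithin 0 (Set.Ioi 0)) (nhds 0) := by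
  have hF := bF_lim ν h0
  have hR : ContinuousAt (bR ν) 0 := by
    unfold bR
    have := Real.continuousAt_rpow_const (0 : ℝ) (-ν) (Or.inr (by linarith))
    have := (bE_cont ν).continuousAt (x := 0)
    have := (bE_cont (-ν)).continuousAt (x := 0)
    fun_prop
  have hv : bR ν 0 = Real.Gamma (-ν) := by
    unfold bR
    rw [Real.zero_rpow (by linarith), bE_zero ν, rG]
    have := Real.Gamma_mul_Gamma_one_sub (-ν)
    rw [show 1 - -ν = ν + 1 by ring, show Real.pi * -ν = -(ν * Real.pi) by ring, Real.sin_neg] at this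
    have hg : Real.Gamma (ν + 1) ≠ 0 := (Real.Gamma_pos_of_pos (by linarith)).ne'
    rw [eq_comm, ← mul_left_inj' hg, this]
    field_simp
    ring
  have := hF.sub (hR.tendsto.mono_left (nhdsWithin_le_nhds (s := Set.Ioi 0)))
  rw [hv, sub_self] at this
  exact this

theorem const_of_lim (f : ℝ → ℝ) (hd : ∀ x, 0 < x → HasDerivAt f 0 x)
    (hl : Tendsto f (nhdsWithin 0 (Set.Ioi 0)) (nhds 0)) (x : ℝ) (hx : 0 < x) : f x = 0 := by
  have hc : ∀ y ∈ Set.Ioi (0 : ℝ), f y = f x := by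
    intro y hy
    refine (convex_Ioi (0 : ℝ)).is_const_of_fderivWithin_eq_zero (𝕜 := ℝ) (f := f)
      (fun z hz => (hd z hz).differentiableAt.differentiableWithinAt) (fun z hz => ?_) hy hx
    rw [fderivWithin_of_isOpen isOpen_Ioi hz]
    ext
    simp [(hd z hz).deriv]
  have h2 : Tendsto f (nhdsWithin 0 (Set.Ioi 0)) (nhds (f x)) := by
    refine tendsto_const_nhds.congr' ?_
    filter_upwards [self_mem_nhdsWithin] with y hy
    exact (hc y hy).symm
  exact tendsto_nhds_unique h2 hl

theorem bH_zero_base (ν : ℝ) (h1 : -1 < ν) (h0 : ν < 0) (x : ℝ) (hx : 0 < x) : bH ν x = 0 := by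
  have hl1 := bH_lim ν h1 h0
  have hl2 := bH_lim (-ν - 1) (by linarith) (by linarith)
  have hE : ∀ c, Tendsto (bE c) (nhdsWithin 0 (Set.Ioi 0)) (nhds (bE c 0)) := fun c =>
    ((bE_cont c).tendsto 0).mono_left nhdsWithin_le_nhds
  have hp : Tendsto (fun x : ℝ => x ^ (ν + 1)) (nhdsWithin 0 (Set.Ioi 0)) (nhds 0) := by
    have := (Real.continuousAt_rpow_const (0 : ℝ) (ν + 1) (Or.inr (by linarith))).tendsto
    rw [Real.zero_rpow (by linarith)] at this
    exact this.mono_left nhdsWithin_le_nhds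
  have hs1 : ∀ x, 0 < x → bH (-ν - 1) x = x ^ (ν + 1) * bH (ν + 1) x := by
    intro x hx
    have := bH_symm (ν + 1) x hx
    rwa [show -(ν + 1) = -ν - 1 by ring] at this
  have hW : ∀ x, 0 < x → bH (-ν - 1) x * bE ν x + x ^ (ν + 1) * bH ν x * bE (ν + 1) x = 0 := by
    refine const_of_lim (fun x => bH (-ν - 1) x * bE ν x + x ^ (ν + 1) * bH ν x * bE (ν + 1) x) ?_ ?_
    · intro x hx
      have d1 := (bH_hasDerivAt (-ν - 1) x hx).mul (bE_hasDerivAt ν x)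
      have d2 := ((Real.hasDerivAt_rpow_const (p := ν + 1) (Or.inl hx.ne')).mul (bH_hasDerivAt ν x hx)).mul
        (bE_hasDerivAt (ν + 1) x)
      refine (d1.add d2).congr_deriv ?_
      rw [show -ν - 1 + 1 = -ν by ring, bH_symm ν x hx, hs1 x hx, bE_rec ν x,
        show ν + 1 + 1 = ν + 2 by ring, show ν + 1 - 1 = ν by ring]
      simp only [Pi.mul_apply]
      rw [Real.rpow_add_one hx.ne']
      ring
    · have := (hl2.mul (hE ν)).add ((hp.mul hl1).mul (hE (ν + 1)))
      simpa using this
  have hQ : ∀ x, 0 < x → bH ν x / bE ν x = 0 := by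
    refine const_of_lim (fun x => bH ν x / bE ν x) ?_ ?_
    · intro x hx
      have hpos := bE_pos ν x h1 hx
      refine ((bH_hasDerivAt ν x hx).div (bE_hasDerivAt ν x) hpos.ne').congr_deriv ?_
      have h := hW x hx
      rw [hs1 x hx] at h
      have h' : x ^ (ν + 1) * (bH (ν + 1) x * bE ν x + bH ν x * bE (ν + 1) x) = 0 := by
        linear_combination h
      rcases mul_eq_zero.1 h' with h'' | h''
      · exact absurd h'' (Real.rpow_pos_of_pos hx _).ne'
      · rw [div_eq_zero_iff]; left; linear_combination -h''
    · have hne : bE ν 0 ≠ 0 := by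
        rw [bE_zero, rG]
        exact inv_ne_zero (Real.Gamma_pos_of_pos (by linarith)).ne'
      have := hl1.div (hE ν) hne
      rw [zero_div] at this
      exact this
  rcases div_eq_zero_iff.1 (hQ x hx) with h | h
  · exact h
  · exact absurd h (bE_pos ν x h1 hx).ne'

theorem bH_zero_up (ν : ℝ) (h : ∀ x, 0 < x → bH ν x = 0) : ∀ x, 0 < x → bH (ν + 1) x = 0 := by
  intro x hx
  have h1 := bH_hasDerivAt ν x hx
  have h2 : HasDerivAt (bH ν) 0 x := by
    refine (hasDerivAt_const x (0 : ℝ)).congr_of_eventuallyEq ?_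
    filter_upwards [Ioi_mem_nhds hx] with y hy
    exact h y hy
  have := h1.unique h2
  linarith

theorem bH_zero_ge (ν : ℝ) (n : ℕ) (h1 : -1 < ν) (h0 : ν < 0) : ∀ x, 0 < x → bH (ν + n) x = 0 := by
  induction n with
  | zero => simpa using bH_zero_base ν h1 h0
  | succ k ih =>
    have := bH_zero_up _ ih
    push_cast
    rwa [← add_assoc]

theorem bH_zero (ν : ℝ) (hν : ∀ m : ℤ, ν ≠ (m : ℝ)) (x : ℝ) (hx : 0 < x) : bH ν x = 0 := by
  have key : ∀ ν : ℝ, (∀ m : ℤ, ν ≠ (m : ℝ)) → -1 < ν → bH ν x = 0 := by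
    intro ν hν hlt
    have hf : (⌊ν⌋ : ℝ) < ν := lt_of_le_of_ne (Int.floor_le ν) (fun h => hν _ h.symm)
    have hf2 := Int.lt_floor_add_one ν
    have hfl : 0 ≤ ⌊ν⌋ + 1 := by
      have : -1 ≤ ⌊ν⌋ := Int.le_floor.2 (by push_cast; linarith)
      linarith
    obtain ⟨n, hn⟩ := Int.eq_ofNat_of_zero_le hfl
    have hn' : (⌊ν⌋ : ℝ) + 1 = n := by exact_mod_cast hn
    have := bH_zero_ge (ν - n) n (by linarith) (by linarith) x hx
    rwa [sub_add_cancel] at this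
  by_cases h : -1 < ν
  · exact key ν hν h
  · have h2 := key (-ν) (fun m hm => hν (-m) (by push_cast; linarith)) (by linarith)
    rw [bH_symm ν x hx] at h2
    rcases mul_eq_zero.1 h2 with h3 | h3
    · exact absurd h3 (Real.rpow_pos_of_pos hx _).ne'
    · exact h3

theorem rpow_two_nat (t ν : ℝ) (ht : 0 < t) (r : ℕ) :
    t ^ (ν + 2 * (r : ℝ)) / (2 : ℝ) ^ (ν + 2 * (r : ℝ)) = (t / 2) ^ ν * (t ^ 2 / 4) ^ r := by
  rw [← Real.div_rpow ht.le (by norm_num), Real.rpow_add (by positivity), Real.rpow_mul (by positivity),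
    Real.rpow_natCast]
  congr 2
  rw [Real.rpow_two]; ring

theorem besselJ_eq (ν t : ℝ) (ht : 0 < t) : besselJ ν t = (t / 2) ^ ν * bE ν (-(t ^ 2 / 4)) := by
  unfold besselJ bE
  rw [← tsum_mul_left]
  refine tsum_congr fun r => ?_
  have h := rpow_two_nat t ν ht r
  rw [neg_pow (t ^ 2 / 4), rG]
  calc _ = (-1 : ℝ) ^ r * (t ^ (ν + 2 * (r : ℝ)) / (2 : ℝ) ^ (ν + 2 * (r : ℝ))) / (Nat.factorial r : ℝ) * (Real.Gamma (ν + r + 1))⁻¹ := by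
        simp only [div_eq_mul_inv, mul_inv]; ring
    _ = _ := by rw [h]; ring

theorem besselI_eq (ν t : ℝ) (ht : 0 < t) : besselI ν t = (t / 2) ^ ν * bE ν (t ^ 2 / 4) := by
  unfold besselI bE
  rw [← tsum_mul_left]
  refine tsum_congr fun r => ?_
  have h := rpow_two_nat t ν ht r
  rw [rG]
  calc _ = (t ^ (ν + 2 * (r : ℝ)) / (2 : ℝ) ^ (ν + 2 * (r : ℝ))) / (Nat.factorial r : ℝ) * (Real.Gamma (ν + r + 1))⁻¹ := by
        simp only [div_eq_mul_inv, mul_inv]; ring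
    _ = _ := by rw [h]; ring

theorem besselK_eq (ν t : ℝ) (hν : ∀ m : ℤ, ν ≠ (m : ℝ)) (ht : 0 < t) :
    besselK ν t = 1 / 2 * (t / 2) ^ (-ν) * bF (-ν) (t ^ 2 / 4) := by
  have h := bH_zero (-ν) (fun m hm => hν (-m) (by push_cast; linarith)) (t ^ 2 / 4) (by positivity)
  rw [bH, sub_eq_zero] at h
  rw [h, bR, besselK, besselI_eq _ _ ht, besselI_eq _ _ ht, neg_neg, neg_mul, Real.sin_neg]
  have e : (t ^ 2 / 4) ^ ν = (t / 2) ^ ν * (t / 2) ^ ν := by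
    rw [← Real.mul_rpow (by positivity) (by positivity)]; congr 1; ring
  have e2 : (t / 2) ^ ν * (t / 2) ^ (-ν) = 1 := by
    rw [← Real.rpow_add (by positivity)]; simp
  rw [e]
  have h1 : Real.pi / (2 * Real.sin (ν * Real.pi)) = 1 / 2 * (Real.pi / Real.sin (ν * Real.pi)) := by
    rw [mul_comm 2, ← div_div]; ring
  have h2 : Real.pi / -Real.sin (ν * Real.pi) = -(Real.pi / Real.sin (ν * Real.pi)) := by
    rw [div_neg]
  rw [h1, h2]
  linear_combination (1 / 2 * (Real.pi / Real.sin (ν * Real.pi)) * (t / 2) ^ ν * bE ν (t ^ 2 / 4)) * e2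

theorem weber (μ A q : ℝ) (hμ : -1 < μ) (hq : 0 < q) :
    ∫ u in Set.Ioi (0 : ℝ), u ^ μ * bE μ (-(A * u)) * Real.exp (-(q * u))
      = (1 / q) ^ (μ + 1) * Real.exp (-(A / q)) := by
  set F : ℕ → ℝ → ℝ := fun r u => ((-A) ^ r / (Nat.factorial r : ℝ) * rG (μ + r + 1)) * (u ^ (μ + r) * Real.exp (-(q * u))) with hF
  have hr : ∀ r : ℕ, -1 < μ + r := fun r => by
    have : (0 : ℝ) ≤ r := r.cast_nonneg
    linarith
  have hg : ∀ r : ℕ, 0 < Real.Gamma (μ + r + 1) := fun r => Real.Gamma_pos_of_pos (by linarith [hr r])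
  have hI : ∀ r : ℕ, ∫ u in Set.Ioi (0 : ℝ), u ^ (μ + r) * Real.exp (-(q * u)) = (1 / q) ^ (μ + 1) * (1 / q) ^ r * Real.Gamma (μ + r + 1) := by
    intro r
    have := Real.integral_rpow_mul_exp_neg_mul_Ioi (a := μ + r + 1) (r := q) (by linarith [hr r]) hq
    rw [add_sub_cancel_right] at this
    rw [this, show μ + r + 1 = μ + 1 + r by ring, Real.rpow_add (by positivity), Real.rpow_natCast]
  have hFi : ∀ r, Integrable (F r) (volume.restrict (Set.Ioi 0)) := fun r => (gam_int (hr r) hq).const_mul _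
  have hFn : ∀ r, ∫ u in Set.Ioi (0 : ℝ), ‖F r u‖ = (1 / q) ^ (μ + 1) * ((|A| / q) ^ r / (Nat.factorial r : ℝ)) := by
    intro r
    have : ∫ u in Set.Ioi (0 : ℝ), ‖F r u‖ = ∫ u in Set.Ioi (0 : ℝ), (|A| ^ r / (Nat.factorial r : ℝ) * rG (μ + r + 1)) * (u ^ (μ + r) * Real.exp (-(q * u))) := by
      refine setIntegral_congr_fun measurableSet_Ioi fun u hu => ?_
      have hu : 0 < u := hu
      simp only [hF]
      have h1 : 0 < rG (μ + r + 1) := inv_pos.2 (hg r)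
      have h2 : 0 < u ^ (μ + r) * Real.exp (-(q * u)) := by positivity
      rw [Real.norm_eq_abs, abs_mul, abs_mul, abs_div, abs_pow, abs_neg, Nat.abs_cast, abs_of_pos h1, abs_of_pos h2]
    rw [this, integral_const_mul, hI, rG, div_pow, div_pow, one_pow]
    have := (hg r).ne'
    field_simp
  have hs := hasSum_integral_of_summable_integral_norm hFi (by
    simp only [hFn]
    exact (Real.summable_pow_div_factorial _).mul_left _)
  have hFint : ∀ r, ∫ u in Set.Ioi (0 : ℝ), F r u = (1 / q) ^ (μ + 1) * ((-(A / q)) ^ r / (Nat.factorial r : ℝ)) := by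
    intro r
    simp only [hF]
    rw [integral_const_mul, hI, rG, ← neg_div, div_pow, div_pow, one_pow]
    have := (hg r).ne'
    field_simp
  simp only [hFint] at hs
  have hexp : HasSum (fun r : ℕ => (1 / q) ^ (μ + 1) * ((-(A / q)) ^ r / (Nat.factorial r : ℝ))) ((1 / q) ^ (μ + 1) * Real.exp (-(A / q))) := by
    rw [Real.exp_eq_exp_ℝ, NormedSpace.exp_eq_tsum_div]
    exact (Real.summable_pow_div_factorial _).hasSum.mul_left _
  rw [← hs.unique hexp]
  refine setIntegral_congr_fun measurableSet_Ioi fun u hu => ?_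
  have hu : 0 < u := hu
  simp only [bE]
  rw [← tsum_mul_left, ← tsum_mul_right]
  refine tsum_congr fun r => ?_
  simp only [hF]
  rw [Real.rpow_add hu, Real.rpow_natCast, ← neg_mul, mul_pow]
  ring

theorem swap_int (μ ν A B : ℝ) (hμ : -1 < μ) (hμν : 0 < μ + ν + 1) (hA : 0 < A) (hB : 0 < B) :
    ∫ u in Set.Ioi (0 : ℝ), u ^ μ * bE μ (-(A * u)) * bF (-ν) (B * u)
      = (1 / B) ^ (μ + 1) * ((1 / (1 + A / B)) ^ (μ + ν + 1) * Real.Gamma (μ + ν + 1)) := by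
  set f : ℝ → ℝ → ℝ := fun u s => u ^ μ * bE μ (-(A * u)) * (s ^ (ν - 1) * Real.exp (-s - B * u / s)) with hf
  have e1 : ∀ u, u ^ μ * bE μ (-(A * u)) * bF (-ν) (B * u) = ∫ s in Set.Ioi (0 : ℝ), f u s := by
    intro u
    simp only [hf]
    rw [integral_const_mul, bF, neg_neg]
  simp only [e1]
  obtain ⟨C, hC, hbd⟩ := bE_neg_bound' μ hμ
  have hEm : Measurable (bE μ) := (bE_cont μ).measurable
  have hmeas : Measurable (Function.uncurry f) := by
    unfold Function.uncurry
    simp only [hf]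
    fun_prop
  have split : ∀ u s : ℝ, 0 < s → f u s = (s ^ (ν - 1) * Real.exp (-s)) * (u ^ μ * bE μ (-(A * u)) * Real.exp (-(B / s * u))) := by
    intro u s hs
    simp only [hf]
    rw [show -s - B * u / s = -s + -(B / s * u) by ring, Real.exp_add]
    ring
  -- the dominating function
  have gI : ∀ s, 0 < s → IntegrableOn (fun u : ℝ => C * (u ^ μ * Real.exp (-(B / s * u)) + A * (u ^ (μ + 1) * Real.exp (-(B / s * u))))) (Set.Ioi 0) := by
    intro s hs
    have hq : 0 < B / s := by positivity
    exact ((gam_int hμ hq).add ((gam_int (by linarith : -1 < μ + 1) hq).const_mul A)).const_mul C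
  have gle : ∀ s u : ℝ, 0 < s → 0 < u → ‖f u s‖ ≤ (s ^ (ν - 1) * Real.exp (-s)) * (C * (u ^ μ * Real.exp (-(B / s * u)) + A * (u ^ (μ + 1) * Real.exp (-(B / s * u))))) := by
    intro s u hs hu
    rw [split u s hs, Real.norm_eq_abs, abs_mul, abs_of_pos (by positivity : 0 < s ^ (ν - 1) * Real.exp (-s))]
    refine mul_le_mul_of_nonneg_left ?_ (by positivity)
    rw [abs_mul, abs_mul, abs_of_pos (Real.exp_pos _), abs_of_pos (Real.rpow_pos_of_pos hu _)]
    have := hbd (A * u) (by positivity)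
    calc _ ≤ u ^ μ * (C * (1 + A * u)) * Real.exp (-(B / s * u)) := by gcongr
      _ = _ := by rw [Real.rpow_add_one hu.ne']; ring
  have fI : ∀ s, 0 < s → Integrable (fun u => f u s) (volume.restrict (Set.Ioi 0)) := by
    intro s hs
    refine Integrable.mono' ((gI s hs).const_mul (s ^ (ν - 1) * Real.exp (-s))) ?_ ?_
    · exact (hmeas.comp (by fun_prop : Measurable fun u : ℝ => (u, s))).aestronglyMeasurable
    · exact (ae_restrict_iff' measurableSet_Ioi).2 (Eventually.of_forall fun u hu => gle s u hs hu)
  have gval : ∀ s, 0 < s → ∫ u in Set.Ioi (0 : ℝ), C * (u ^ μ * Real.exp (-(B / s * u)) + A * (u ^ (μ + 1) * Real.exp (-(B / s * u))))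
      = C * ((1 / B) ^ (μ + 1) * s ^ (μ + 1) * Real.Gamma (μ + 1) + A * ((1 / B) ^ (μ + 1 + 1) * s ^ (μ + 1 + 1) * Real.Gamma (μ + 1 + 1))) := by
    intro s hs
    have hq : 0 < B / s := by positivity
    have hh : ∀ c : ℝ, -1 < c → ∫ u in Set.Ioi (0 : ℝ), u ^ c * Real.exp (-(B / s * u)) = (1 / B) ^ (c + 1) * s ^ (c + 1) * Real.Gamma (c + 1) := by
      intro c hc
      have := Real.integral_rpow_mul_exp_neg_mul_Ioi (a := c + 1) (r := B / s) (by linarith) hq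
      rw [add_sub_cancel_right] at this
      rw [this, ← Real.mul_rpow (by positivity) hs.le]
      congr 2
      field_simp
    rw [integral_const_mul, integral_add (gam_int hμ hq) ((gam_int (by linarith : -1 < μ + 1) hq).const_mul A),
      integral_const_mul, hh _ hμ, hh _ (by linarith)]
  have hprod : Integrable (Function.uncurry f) ((volume.restrict (Set.Ioi (0 : ℝ))).prod (volume.restrict (Set.Ioi (0 : ℝ)))) := by
    rw [integrable_prod_iff' hmeas.aestronglyMeasurable]
    refine ⟨(ae_restrict_iff' measurableSet_Ioi).2 (Eventually.of_forall fun s hs => fI s hs), ?_⟩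
    have i1 := (gam_int (c := μ + ν) (q := 1) (by linarith) one_pos).const_mul (C * ((1 / B) ^ (μ + 1) * Real.Gamma (μ + 1)))
    have i2 := (gam_int (c := μ + ν + 1) (q := 1) (by linarith) one_pos).const_mul (C * A * ((1 / B) ^ (μ + 1 + 1) * Real.Gamma (μ + 1 + 1)))
    refine Integrable.mono' (i1.add i2) ?_ ?_
    · exact (hmeas.norm.stronglyMeasurable.integral_prod_left).aestronglyMeasurable
    · refine (ae_restrict_iff' measurableSet_Ioi).2 (Eventually.of_forall fun s hs => ?_)
      have hs : 0 < s := hs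
      rw [Real.norm_eq_abs, abs_of_nonneg (integral_nonneg fun _ => norm_nonneg _)]
      have h1 : ∫ u in Set.Ioi (0 : ℝ), ‖f u s‖ ≤ ∫ u in Set.Ioi (0 : ℝ), (s ^ (ν - 1) * Real.exp (-s)) * (C * (u ^ μ * Real.exp (-(B / s * u)) + A * (u ^ (μ + 1) * Real.exp (-(B / s * u))))) :=
        setIntegral_mono_on (fI s hs).norm ((gI s hs).const_mul _) measurableSet_Ioi (fun u hu => gle s u hs hu)
      refine h1.trans (le_of_eq ?_)
      rw [integral_const_mul, gval s hs]
      simp only [Pi.add_apply, one_mul]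
      have p1 : s ^ (μ + ν) = s ^ (ν - 1) * s ^ (μ + 1) := by
        rw [← Real.rpow_add hs]; congr 1; ring
      have p2 : s ^ (μ + ν + 1) = s ^ (ν - 1) * s ^ (μ + 1 + 1) := by
        rw [← Real.rpow_add hs]; congr 1; ring
      rw [p1, p2]
      ring
  rw [integral_integral_swap hprod]
  have fin : ∀ s ∈ Set.Ioi (0 : ℝ), ∫ u in Set.Ioi (0 : ℝ), f u s = (1 / B) ^ (μ + 1) * (s ^ (μ + ν + 1 - 1) * Real.exp (-((1 + A / B) * s))) := by
    intro s hs
    have hs : 0 < s := hs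
    simp only [split _ s hs]
    rw [integral_const_mul, weber μ A (B / s) hμ (by positivity)]
    have p1 : (1 / (B / s)) ^ (μ + 1) = (1 / B) ^ (μ + 1) * s ^ (μ + 1) := by
      rw [← Real.mul_rpow (by positivity) hs.le]; congr 1; field_simp
    have p2 : s ^ (μ + ν + 1 - 1) = s ^ (ν - 1) * s ^ (μ + 1) := by
      rw [← Real.rpow_add hs]; congr 1; ring
    have p3 : -((1 + A / B) * s) = -s + -(A / (B / s)) := by field_simp; ring
    rw [p1, p2, p3, Real.exp_add]
    ring
  rw [setIntegral_congr_fun measurableSet_Ioi fin, integral_const_mul,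
    Real.integral_rpow_mul_exp_neg_mul_Ioi hμν (by positivity)]

/-- Watson's formula: for `a, b > 0`, `ν` non-integer, `μ + 1 > |ν|`,
`∫_0^∞ t^{μ+ν+1} J_μ(at) K_ν(bt) dt = (2a)^μ (2b)^ν Γ(μ+ν+1) / (a²+b²)^{μ+ν+1}`. -/
theorem integral_rpow_besselJ_mul_besselK (a b μ ν : ℝ) (ha : 0 < a) (hb : 0 < b)
    (hν : ∀ m : ℤ, ν ≠ (m : ℝ)) (hμν : μ + 1 > |ν|) :
    ∫ t in Set.Ioi (0 : ℝ), t ^ (μ + ν + 1) * besselJ μ (a * t) * besselK ν (b * t)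
      = (2 * a) ^ μ * (2 * b) ^ ν * Real.Gamma (μ + ν + 1) / (a ^ 2 + b ^ 2) ^ (μ + ν + 1) := by
  have hμ : -1 < μ := by linarith [abs_nonneg ν]
  have hμν' : 0 < μ + ν + 1 := by linarith [neg_abs_le ν]
  have hA : 0 < a ^ 2 / 4 := by positivity
  have hB : 0 < b ^ 2 / 4 := by positivity
  have key := swap_int μ ν (a ^ 2 / 4) (b ^ 2 / 4) hμ hμν' hA hB
  rw [← integral_comp_rpow_Ioi_of_pos (p := 2) two_pos] at key
  have h1 : ∀ t ∈ Set.Ioi (0 : ℝ), t ^ (μ + ν + 1) * besselJ μ (a * t) * besselK ν (b * t) =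
      (1 / 4 * (a / 2) ^ μ * (b / 2) ^ (-ν)) * (((2 : ℝ) * t ^ ((2 : ℝ) - 1)) • ((t ^ (2 : ℝ)) ^ μ * bE μ (-(a ^ 2 / 4 * t ^ (2 : ℝ))) *
        bF (-ν) (b ^ 2 / 4 * t ^ (2 : ℝ)))) := by
    intro t ht
    have ht : 0 < t := ht
    rw [besselJ_eq _ _ (by positivity), besselK_eq _ _ hν (by positivity)]
    have e1 : (a * t) ^ 2 / 4 = a ^ 2 / 4 * t ^ (2 : ℝ) := by rw [Real.rpow_two]; ring
    have e2 : (b * t) ^ 2 / 4 = b ^ 2 / 4 * t ^ (2 : ℝ) := by rw [Real.rpow_two]; ring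
    have e3 : (a * t / 2) ^ μ = (a / 2) ^ μ * t ^ μ := by
      rw [← Real.mul_rpow (by positivity) ht.le]; congr 1; ring
    have e4 : (b * t / 2) ^ (-ν) = (b / 2) ^ (-ν) * t ^ (-ν) := by
      rw [← Real.mul_rpow (by positivity) ht.le]; congr 1; ring
    have e5 : t ^ (μ + ν + 1) * t ^ μ * t ^ (-ν) = t ^ ((2 : ℝ) - 1) * (t ^ (2 : ℝ)) ^ μ := by
      rw [← Real.rpow_mul ht.le, ← Real.rpow_add ht, ← Real.rpow_add ht, ← Real.rpow_add ht]
      congr 1; ring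
    rw [e1, e2, e3, e4, smul_eq_mul]
    linear_combination (1 / 2 * (a / 2) ^ μ * (b / 2) ^ (-ν) * bE μ (-(a ^ 2 / 4 * t ^ (2 : ℝ))) * bF (-ν) (b ^ 2 / 4 * t ^ (2 : ℝ))) * e5
  rw [setIntegral_congr_fun measurableSet_Ioi h1, integral_const_mul, key]
  have hS : 0 < a ^ 2 + b ^ 2 := by positivity
  have q1 : 1 / (1 + a ^ 2 / 4 / (b ^ 2 / 4)) = b ^ 2 / (a ^ 2 + b ^ 2) := by
    field_simp; ring
  have q2 : (1 / (b ^ 2 / 4)) = (2 / b) ^ 2 := by field_simp; norm_num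
  rw [q1, q2, Real.div_rpow (by positivity) hS.le]
  have pw : ∀ x c : ℝ, 0 < x → (x ^ 2) ^ c = x ^ c * x ^ c := by
    intro x c hx
    rw [← Real.mul_rpow hx.le hx.le]; congr 1; ring
  rw [pw _ _ (by positivity), pw _ _ hb]
  rw [Real.div_rpow (by positivity) hb.le, Real.div_rpow ha.le (by positivity),
    Real.div_rpow hb.le (by positivity), Real.mul_rpow (by positivity) ha.le, Real.mul_rpow (by positivity) hb.le]
  simp only [Real.rpow_neg hb.le, Real.rpow_neg (zero_le_two : (0 : ℝ) ≤ 2), Real.rpow_add hb, Real.rpow_one,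
    Real.rpow_add (zero_lt_two : (0 : ℝ) < 2)]
  have n1 : (a ^ 2 + b ^ 2) ^ (μ + ν + 1) ≠ 0 := (Real.rpow_pos_of_pos hS _).ne'
  have n2 : b ^ μ ≠ 0 := (Real.rpow_pos_of_pos hb _).ne'
  have n3 : b ^ ν ≠ 0 := (Real.rpow_pos_of_pos hb _).ne'
  have n4 : (2 : ℝ) ^ μ ≠ 0 := (Real.rpow_pos_of_pos two_pos _).ne'
  have n5 : (2 : ℝ) ^ ν ≠ 0 := (Real.rpow_pos_of_pos two_pos _).ne'
  generalize (a ^ 2 + b ^ 2) ^ (μ + ν + 1) = S at *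
  generalize b ^ μ = X1 at *
  generalize b ^ ν = X2 at *
  generalize (2 : ℝ) ^ μ = X3 at *
  generalize (2 : ℝ) ^ ν = X4 at *
  field_simp
  try norm_num
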